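/- arXiv:0711.3183 — 2 statements merged into one kernel-verified Lean document; each statement's English description precedes it below -/
import Mathlib

section
/- Let k ≥ 2 and n ≥ 1 be integers, and work over the two-letter alphabet {a, b}. Let u = (ab)ⁿ·a, let x = uᵏ, and let v = uᵏ·ba·u^{k−1}. Then there exists a word y such that vᵏ = x·y·x; moreover x and x·y·x are k-powers, but the word x·y·x·y·x is not a k-power. -/
/-- `listPow x m` is the concatenation of `m` copies of the word `x`. -/
def listPow {α : Type*} (x : List α) (m : ℕ) : List α := (List.replicate m x).flatten

/-- A word is a `k`-power if it is the concatenation of `k` copies of a non-empty word. -/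
def IsKPower {α : Type*} (k : ℕ) (w : List α) : Prop :=
  ∃ x : List α, x ≠ [] ∧ w = listPow x k

/-- A word is a power if it is a `k`-power for some `k ≥ 2`. -/
def IsPower {α : Type*} (w : List α) : Prop := ∃ k : ℕ, 2 ≤ k ∧ IsKPower k w

/-- A non-empty word is primitive if it is not a power. -/
def IsPrimitive {α : Type*} (w : List α) : Prop := w ≠ [] ∧ ¬ IsPower w

/-- A word is bordered if it has the form `u ++ w ++ u` with `u` non-empty. -/
def Bordered {α : Type*} (x : List α) : Prop :=
  ∃ u w : List α, u ≠ [] ∧ x = u ++ w ++ u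

/-- A language is slender if the number of words of each length is bounded by a constant. -/
def Slender {α : Type*} (L : Language α) : Prop :=
  ∃ C : ℕ, ∀ r : ℕ, {w | w ∈ L ∧ w.length = r}.Finite ∧
    {w | w ∈ L ∧ w.length = r}.ncard < C

theorem lp_succ {α : Type*} (x : List α) (m : ℕ) : listPow x (m+1) = x ++ listPow x m := by
  simp [listPow, List.replicate_succ]

theorem lp_succ' {α : Type*} (x : List α) (m : ℕ) : listPow x (m+1) = listPow x m ++ x := by
  simp [listPow, List.replicate_succ']

theorem lp_length {α : Type*} (x : List α) (m : ℕ) : (listPow x m).length = m * x.length := by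
  simp [listPow]

theorem lp_comm {α : Type*} (a b : α) (n : ℕ) :
    (listPow [a, b] n ++ [a]) ++ [b, a] = [a, b] ++ (listPow [a, b] n ++ [a]) := by
  have h : listPow [a, b] n ++ [a, b] = [a, b] ++ listPow [a, b] n := by
    rw [← lp_succ, ← lp_succ']
  have h2 := congrArg (· ++ [a]) h
  simpa using h2

/-- With u = (ab)ⁿa, x = uᵏ and v = uᵏ·ba·u^(k-1), there is a word y with vᵏ = x·y·x;
the words x and x·y·x are k-powers, but x·y·x·y·x is not a k-power. -/
theorem ito_katsura_shyr_yu_example {α : Type*} (a b : α) (hab : a ≠ b)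
    (k n : ℕ) (hk : 2 ≤ k) (hn : 1 ≤ n) :
    ∃ y : List α,
      listPow (listPow (listPow [a, b] n ++ [a]) k ++ [b, a] ++
          listPow (listPow [a, b] n ++ [a]) (k - 1)) k =
        listPow (listPow [a, b] n ++ [a]) k ++ y ++ listPow (listPow [a, b] n ++ [a]) k ∧
      IsKPower k (listPow (listPow [a, b] n ++ [a]) k) ∧
      IsKPower k (listPow (listPow [a, b] n ++ [a]) k ++ y ++
        listPow (listPow [a, b] n ++ [a]) k) ∧
      ¬ IsKPower k (listPow (listPow [a, b] n ++ [a]) k ++ y ++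
        listPow (listPow [a, b] n ++ [a]) k ++ y ++
        listPow (listPow [a, b] n ++ [a]) k) := by
  obtain ⟨j, rfl⟩ : ∃ j, k = j + 2 := ⟨k - 2, by omega⟩
  have hc := lp_comm a b n
  have hU0 : listPow [a, b] n ++ [a] ≠ [] := by simp
  generalize listPow [a, b] n ++ [a] = U at hc hU0 ⊢
  have e1 : listPow U (j + 2) = U ++ listPow U (j + 1) := lp_succ _ _
  have e2 : listPow U (j + 2) = listPow U (j + 1) ++ U := lp_succ' _ _
  have hxl := lp_length U (j + 2)
  rw [show j + 2 - 1 = j + 1 from rfl]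
  have hx : IsKPower (j + 2) (listPow U (j + 2)) := ⟨U, hU0, rfl⟩
  generalize listPow U (j + 2) = x at *
  generalize listPow U (j + 1) = P at *
  have hv : x ++ [b, a] ++ P = P ++ [a, b] ++ x := by
    calc x ++ [b, a] ++ P = P ++ (U ++ [b, a]) ++ P := by rw [e2]; simp
      _ = P ++ [a, b] ++ x := by rw [hc, e1]; simp
  have hv0 : x ++ [b, a] ++ P ≠ [] := by simp
  have hvl : (x ++ [b, a] ++ P).length + U.length = 2 * x.length + 2 := by
    have := congrArg List.length e1
    simp at this ⊢
    omega
  generalize hV : x ++ [b, a] ++ P = V at *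
  have hVk : listPow V (j + 2) =
      x ++ ([b, a] ++ P ++ listPow V j ++ P ++ [a, b]) ++ x := by
    rw [lp_succ, lp_succ']
    nth_rewrite 1 [← hV]
    nth_rewrite 2 [hv]
    simp
  have hsuf : listPow V (j + 2) = listPow V j ++ U ++ (P ++ [b, a] ++ P ++ V) := by
    rw [lp_succ', lp_succ']
    nth_rewrite 2 [← hV]
    rw [e1]
    simp
  generalize hy : [b, a] ++ P ++ listPow V j ++ P ++ [a, b] = y at hVk
  refine ⟨y, hVk, hx, ⟨V, hv0, hVk.symm⟩, ?_⟩
  rintro ⟨z, -, hz⟩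
  have hpre : x ++ y ++ x ++ y ++ x = P ++ ([a, b] ++ x ++ listPow V (j+1) ++ y ++ x) := by
    rw [← hVk, lp_succ]
    nth_rewrite 1 [hv]
    simp
  have hz1 : listPow z (j + 1) ++ z =
      (x ++ y ++ listPow V j ++ U) ++ (P ++ [b, a] ++ P ++ V) := by
    rw [← lp_succ', ← hz]
    calc x ++ y ++ x ++ y ++ x = x ++ y ++ (x ++ y ++ x) := by simp
      _ = _ := by rw [← hVk, hsuf]; simp
  have hzl : z.length = (P ++ [b, a] ++ P ++ V).length := by
    have l1 := congrArg List.length hz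
    have l2 := congrArg List.length hVk
    have l3 := congrArg List.length e1
    have l4 := congrArg List.length hV
    rw [lp_length] at l1 l2
    simp only [List.length_append, List.length_cons, List.length_nil] at l1 l2 l3 l4 ⊢
    have : (j + 2) * (z.length + U.length) = (j + 2) * (2 * V.length) := by
      rw [mul_add, ← hxl, ← l1, mul_left_comm, l2]
      ring
    have := Nat.eq_of_mul_eq_mul_left (by omega) this
    omega
  have hzz := List.append_inj_right' hz1 hzl
  have hfin : P ++ ([a, b] ++ x ++ listPow V (j+1) ++ y ++ x) =
      P ++ ([b, a] ++ P ++ V ++ listPow z (j+1)) := by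
    rw [← hpre, hz, lp_succ]
    nth_rewrite 1 [hzz]
    simp
  have := List.append_cancel_left hfin
  simp at this
  exact hab this.1
end

section
/- Let M be an NFA with n states and let L be the language accepted by M. If L contains an unbordered word of length greater than 4n² + 6n + 1, then L contains infinitely many unbordered words. -/
/-- Index version of having a border. -/
def BorderI {β : Type*} (f : ℕ → β) (N k : ℕ) : Prop :=
  0 < k ∧ k < N ∧ ∀ t < k, f t = f (N - k + t)

lemma borderI_shortest {β : Type*} {f : ℕ → β} {N : ℕ} (h : ∃ k, BorderI f N k) :
    ∃ k, BorderI f N k ∧ 2 * k ≤ N ∧ ∀ r, BorderI f N r → k ≤ r := by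
  classical
  refine ⟨Nat.find h, Nat.find_spec h, ?_, fun r hr => Nat.find_min' h hr⟩
  by_contra hc
  obtain ⟨h0, h1, h2⟩ := Nat.find_spec h
  have hmin := fun r (hr : BorderI f N r) => Nat.find_min' h hr
  generalize Nat.find h = k at *
  have : BorderI f N (2 * k - N) := by
    refine ⟨by omega, by omega, fun t ht => ?_⟩
    rw [h2 t (by omega), h2 (N - k + t) (by omega)]
    congr 1; omega
  have := hmin _ this
  omega

lemma bordered_iff {α : Type*} (w : List α) :
    Bordered w ↔ ∃ k, BorderI (fun t => w[t]?) w.length k := by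
  constructor
  · rintro ⟨u, v, hu, rfl⟩
    have hl : 0 < u.length := List.length_pos_iff.2 hu
    refine ⟨u.length, hl, by simp; omega, fun t ht => ?_⟩
    show (u ++ v ++ u)[t]? = (u ++ v ++ u)[_]?
    rw [List.append_assoc, List.getElem?_append_left ht, ← List.append_assoc,
      List.getElem?_append_right (by simp; omega)]
    congr 1; simp; omega
  · intro h
    obtain ⟨k, ⟨h0, h1, h2⟩, h3, -⟩ := borderI_shortest h
    refine ⟨w.take k, (w.drop k).take (w.length - 2 * k), ?_, ?_⟩
    · rw [← List.length_pos_iff, List.length_take]; omega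
    · have e : w.drop (w.length - k) = w.take k := by
        apply List.ext_getElem?
        intro t
        rw [List.getElem?_drop, List.getElem?_take]
        split_ifs with ht
        · exact (h2 t ht).symm
        · exact List.getElem?_eq_none (by omega)
      conv_lhs => rw [← List.take_append_drop k w,
        ← List.take_append_drop (w.length - 2 * k) (w.drop k), List.drop_drop]
      rw [show k + (w.length - 2 * k) = w.length - k by omega, e, List.append_assoc]

lemma period_mul {β : Type*} {f : ℕ → β} {a b l : ℕ}
    (h : ∀ t, a ≤ t → t + l < b → f t = f (t + l)) (c : ℕ) :
    ∀ t, a ≤ t → t + c * l < b → f t = f (t + c * l) := by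
  induction c with
  | zero => simp
  | succ c ih =>
    intro t ha hb
    rw [Nat.succ_mul] at hb ⊢
    rw [ih t ha (by omega), h (t + c * l) (by omega) (by omega)]
    congr 1; omega

lemma core {β : Type*} (f : ℕ → β) (N s l k1 k2 : ℕ) (hl : 0 < l) (hN : 2 * s + 2 * l ≤ N)
    (hk1 : s + l < k1) (hk1N : k1 ≤ N) (hk2 : s + l < k2) (hle : k2 ≤ k1)
    (h1 : ∀ t, t < s + l → f (N - k1 + t) = f t)
    (h1' : ∀ t, s ≤ t → t + l < k1 → f (N - k1 + t) = f (N - k1 + (t + l)))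
    (h2 : ∀ t, k2 ≤ t + s + l → t < k2 → f t = f (N - k2 + t))
    (h2' : ∀ t, t + l + s < k2 → f t = f (t + l)) :
    ∃ k, BorderI f N k := by
  by_cases hP : ∀ t, t < s → f t = f (t + l)
  · have hG : ∀ t, 0 ≤ t → t + l < k1 → (fun t => f (N - k1 + t)) t
        = (fun t => f (N - k1 + t)) (t + l) := by
      intro t _ ht
      by_cases hts : s ≤ t
      · exact h1' t hts ht
      · show f (N - k1 + t) = f (N - k1 + (t + l))
        rw [h1 t (by omega), h1 (t + l) (by omega)]
        exact hP t (by omega)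
    have hm := period_mul hG ((k1 - 1) / l)
    have hd := Nat.div_add_mod (k1 - 1) l
    have hml := Nat.mod_lt (k1 - 1) hl
    rw [Nat.mul_comm] at hd
    refine ⟨(k1 - 1) % l + 1, by omega, by omega, fun t ht => ?_⟩
    have := hm t (by omega) (by omega)
    rw [h1 t (by omega)] at this
    rw [this]; congr 1; omega
  · have hk2s : k2 < 2 * s + l := by
      by_contra hc
      exact hP fun t ht => h2' t (by omega)
    rcases Nat.eq_or_lt_of_le hle with rfl | hlt
    · refine ⟨k2, by omega, by omega, fun t ht => ?_⟩
      by_cases hts : t < s + l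
      · exact (h1 t hts).symm
      · exact h2 t (by omega) ht
    · exfalso
      apply hP
      have hGd : ∀ t, k2 ≤ t + s + l → t < s + l →
          f (N - k1 + t) = f (N - k1 + (t + (k1 - k2))) := by
        intro t ht1 ht2
        rw [h1 t ht2, h2 t ht1 (by omega)]
        congr 1; omega
      have hGl : ∀ m t, k1 - t ≤ m → k2 ≤ t + s + l → t + l < k1 → t + l < s + l + (k1 - k2) →
          f (N - k1 + t) = f (N - k1 + (t + l)) := by
        intro m
        induction m with
        | zero => intro t; omega
        | succ m ih =>
          intro t hm ht1 ht2 ht3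
          by_cases hts : s ≤ t
          · exact h1' t hts ht2
          · rw [hGd t ht1 (by omega), hGd (t + l) (by omega) (by omega),
              ih (t + (k1 - k2)) (by omega) (by omega) (by omega) (by omega)]
            congr 1; omega
      intro t ht
      by_cases htk : t + l + s < k2
      · exact h2' t htk
      · have := hGl _ t le_rfl (by omega) (by omega) (by omega)
        rwa [h1 t (by omega), h1 (t + l) (by omega)] at this

/-- Pumping lemma on index level. -/
lemma pumpI {β : Type*} (f W : ℕ → β) (N N' s l i : ℕ) (hl : 0 < l) (hN : 2 * s + 2 * l ≤ N)
    (hN' : N' + l = N + i * l) (hi : N ≤ i * l)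
    (w1 : ∀ t, t < s + l → W t = f t)
    (w2 : ∀ t, s ≤ t → t + l < s + i * l → W t = W (t + l))
    (w3 : ∀ t, t < N - s → W (N' - 1 - t) = f (N - 1 - t))
    (hb : ∃ k, BorderI W N' k) (hnb : ¬ ∃ k, BorderI f N k) :
    ∃ k, s + l < k ∧ k ≤ N ∧ (∀ t, t < s + l → f (N - k + t) = f t) ∧
      (∀ t, s ≤ t → t + l < k → f (N - k + t) = f (N - k + (t + l))) := by
  obtain ⟨k, ⟨h0, h1, h2⟩, h3, hmin⟩ := borderI_shortest hb
  have w3' : ∀ t, k ≤ N - s → t < k → W (N' - k + t) = f (N - k + t) := by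
    intro t hk ht
    have := w3 (k - 1 - t) (by omega)
    rw [show N' - 1 - (k - 1 - t) = N' - k + t by omega,
      show N - 1 - (k - 1 - t) = N - k + t by omega] at this
    exact this
  have hk1 : s + l < k := by
    by_contra hc
    exact hnb ⟨k, h0, by omega, fun t ht => by
      rw [← w1 t (by omega), h2 t ht, w3' t (by omega) ht]⟩
  by_cases hkN : k ≤ N - s
  · refine ⟨k, hk1, by omega, fun t ht => ?_, fun t ht1 ht2 => ?_⟩
    · rw [← w3' t hkN (by omega), ← h2 t (by omega), w1 t ht]
    · rw [← w3' t hkN (by omega), ← w3' (t + l) hkN (by omega), ← h2 t (by omega),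
        ← h2 (t + l) (by omega)]
      exact w2 t ht1 (by omega)
  · exfalso
    have hm := period_mul w2 ((N' - k - k) / l + 1)
    have hd := Nat.div_add_mod (N' - k - k) l
    have hml := Nat.mod_lt (N' - k - k) hl
    rw [Nat.mul_comm] at hd
    rw [Nat.succ_mul] at hm
    have : BorderI W N' (l - (N' - k - k) % l) := by
      refine ⟨by omega, by omega, fun t ht => ?_⟩
      rw [h2 t (by omega)]
      have h4 := hm (k - (l - (N' - k - k) % l) + t) (by omega) (by omega)
      rw [h2 _ (by omega)] at h4
      rw [show N' - (l - (N' - k - k) % l) + t = N' - k + (k - (l - (N' - k - k) % l) + t) by omega,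
        h4]
      congr 1; omega
    have := hmin _ this
    omega

lemma listPow_succ {α : Type*} (y : List α) (i : ℕ) : listPow y (i + 1) = y ++ listPow y i := by
  simp [listPow, List.replicate_succ]

lemma listPow_succ' {α : Type*} (y : List α) (i : ℕ) : listPow y (i + 1) = listPow y i ++ y := by
  simp [listPow, List.replicate_succ']

lemma listPow_length {α : Type*} (y : List α) (i : ℕ) : (listPow y i).length = i * y.length := by
  simp [listPow]

lemma listPow_reverse {α : Type*} (y : List α) (i : ℕ) :
    (listPow y i).reverse = listPow y.reverse i := by
  induction i with
  | zero => simp [listPow]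
  | succ i ih => rw [listPow_succ, List.reverse_append, ih, ← listPow_succ']

lemma bordered_reverse {α : Type*} {w : List α} (h : Bordered w) : Bordered w.reverse := by
  obtain ⟨u, v, hu, rfl⟩ := h
  exact ⟨u.reverse, v.reverse, by simpa using hu, by simp⟩

lemma pumpL {α : Type*} (x y m : List α) (j : ℕ) (hy : 0 < y.length)
    (hm : x.length + y.length ≤ m.length) (hj : (x ++ y ++ m).length ≤ j)
    (hb : Bordered (x ++ listPow y (j + 1) ++ m)) (hnb : ¬ Bordered (x ++ y ++ m)) :
    ∃ k, x.length + y.length < k ∧ k ≤ (x ++ y ++ m).length ∧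
      (∀ t, t < x.length + y.length →
        (x ++ y ++ m)[(x ++ y ++ m).length - k + t]? = (x ++ y ++ m)[t]?) ∧
      (∀ t, x.length ≤ t → t + y.length < k →
        (x ++ y ++ m)[(x ++ y ++ m).length - k + t]?
          = (x ++ y ++ m)[(x ++ y ++ m).length - k + (t + y.length)]?) := by
  rw [bordered_iff] at hb hnb
  have hle : j ≤ j * y.length := Nat.le_mul_of_pos_right _ hy
  have hlen := listPow_length y j
  refine pumpI (fun t => (x ++ y ++ m)[t]?) (fun t => (x ++ listPow y (j + 1) ++ m)[t]?)
    (x ++ y ++ m).length (x ++ listPow y (j + 1) ++ m).length x.length y.length (j + 1) hy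
    ?_ ?_ ?_ ?_ ?_ ?_ hb hnb
  · simp only [List.length_append]; omega
  · simp only [List.length_append, listPow_length]; omega
  · rw [Nat.succ_mul]; omega
  · intro t ht
    have e : x ++ listPow y (j + 1) ++ m = (x ++ y) ++ (listPow y j ++ m) := by
      rw [listPow_succ]; simp
    have ht' : t < (x ++ y).length := by rw [List.length_append]; exact ht
    show (x ++ listPow y (j + 1) ++ m)[t]? = (x ++ y ++ m)[t]?
    rw [e, List.getElem?_append_left (l₁ := x ++ y) ht',
      List.getElem?_append_left (l₁ := x ++ y) ht']
  · intro t ht1 ht2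
    rw [Nat.succ_mul] at ht2
    have hL : (x ++ listPow y (j + 1)).length = x.length + (j * y.length + y.length) := by
      rw [List.length_append, listPow_length, Nat.succ_mul]
    show (x ++ listPow y (j + 1) ++ m)[t]? = (x ++ listPow y (j + 1) ++ m)[t + y.length]?
    rw [List.getElem?_append_left (l₁ := x ++ listPow y (j + 1)) (by omega),
      List.getElem?_append_left (l₁ := x ++ listPow y (j + 1)) (by omega),
      List.getElem?_append_right ht1, List.getElem?_append_right (by omega)]
    conv_lhs => rw [listPow_succ']
    rw [listPow_succ, List.getElem?_append_left (by omega), List.getElem?_append_right (by omega)]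
    congr 1; omega
  · intro t ht
    have e : x ++ listPow y (j + 1) ++ m = (x ++ listPow y j) ++ (y ++ m) := by
      rw [listPow_succ']; simp
    rw [e, List.append_assoc x y m] at *
    simp only [List.length_append] at ht
    show ((x ++ listPow y j) ++ (y ++ m))[_]? = (x ++ (y ++ m))[_]?
    rw [List.getElem?_append_right (l₁ := x ++ listPow y j)
        (by simp only [List.length_append]; omega),
      List.getElem?_append_right (l₁ := x) (by simp only [List.length_append]; omega)]
    congr 1; simp only [List.length_append]; omega

/-- The combinatorial heart. -/
lemma words {α : Type*} (x y m y' z : List α) (j : ℕ) (hy : 0 < y.length)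
    (hyy : y'.length = y.length) (hxz : z.length = x.length)
    (hj : (x ++ y ++ m ++ y' ++ z).length ≤ j)
    (hb1 : Bordered (x ++ listPow y (j + 1) ++ (m ++ y' ++ z)))
    (hb2 : Bordered (x ++ y ++ m ++ listPow y' (j + 1) ++ z)) :
    Bordered (x ++ y ++ m ++ y' ++ z) := by
  by_contra hnb
  have e1 : x ++ y ++ m ++ y' ++ z = x ++ y ++ (m ++ y' ++ z) := by simp
  have e2 : (x ++ y ++ m ++ y' ++ z).reverse
      = z.reverse ++ y'.reverse ++ (x ++ y ++ m).reverse := by simp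
  have hnb' : ¬ Bordered (x ++ y ++ m ++ y' ++ z).reverse := fun h =>
    hnb (by simpa using bordered_reverse h)
  obtain ⟨k1, a1, a2, a3, a4⟩ := pumpL x y (m ++ y' ++ z) j hy (by simp; omega)
    (by rwa [← e1]) hb1 (by rwa [← e1])
  rw [← e1] at a2 a3 a4
  have hb2' := bordered_reverse hb2
  rw [List.reverse_append, List.reverse_append, listPow_reverse, ← List.append_assoc] at hb2'
  obtain ⟨k2, b1, b2, b3, b4⟩ := pumpL z.reverse y'.reverse (x ++ y ++ m).reverse j (by simp; omega)
    (by simp; omega) (by rw [← e2, List.length_reverse]; exact hj) hb2' (by rwa [← e2])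
  rw [← e2] at b2 b3 b4
  simp only [List.length_reverse, hyy, hxz] at b1 b2 b3 b4
  have hN : 2 * x.length + 2 * y.length ≤ (x ++ y ++ m ++ y' ++ z).length := by
    simp; omega
  rw [bordered_iff] at hnb hnb'
  rw [List.length_reverse] at hnb'
  generalize x ++ y ++ m ++ y' ++ z = w at *
  have hr : ∀ t, t < w.length → w.reverse[t]? = w[w.length - 1 - t]? := fun t ht =>
    List.getElem?_reverse ht
  have hr' : ∀ t, t < w.length → w[t]? = w.reverse[w.length - 1 - t]? := fun t ht => by
    rw [hr _ (by omega)]; congr 1; omega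
  rcases le_total k2 k1 with hk | hk
  · apply hnb
    refine core (fun t => w[t]?) w.length x.length y.length k1 k2 hy hN a1 a2 b1 hk a3 a4 ?_ ?_
    · intro t ht1 ht2
      have := b3 (k2 - 1 - t) (by omega)
      rw [hr _ (by omega), hr _ (by omega)] at this
      convert this using 2 <;> omega
    · intro t ht
      have := b4 (k2 - 1 - t - y.length) (by omega) (by omega)
      rw [hr _ (by omega), hr _ (by omega)] at this
      convert this.symm using 2 <;> omega
  · apply hnb'
    refine core (fun t => w.reverse[t]?) w.length x.length y.length k2 k1 hy hN b1 b2 a1 hk b3 b4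
      ?_ ?_
    · intro t ht1 ht2
      have := a3 (k1 - 1 - t) (by omega)
      rw [hr' _ (by omega), hr' _ (by omega)] at this
      convert this using 2 <;> omega
    · intro t ht
      have := a4 (k1 - 1 - t - y.length) (by omega) (by omega)
      rw [hr' _ (by omega), hr' _ (by omega)] at this
      convert this.symm using 2 <;> omega

/-- Reachability by a word. -/
inductive Run {α σ : Type*} (M : NFA α σ) : σ → List α → σ → Prop
  | nil (p : σ) : Run M p [] p
  | cons (p q r : σ) (a : α) (w : List α) : q ∈ M.step p a → Run M q w r → Run M p (a :: w) r

lemma Run.append {α σ : Type*} {M : NFA α σ} {p q r : σ} {u v : List α}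
    (h1 : Run M p u q) (h2 : Run M q v r) : Run M p (u ++ v) r := by
  induction h1 with
  | nil p => exact h2
  | cons p q _ a w hs _ ih => exact Run.cons _ _ _ _ _ hs (ih h2)

lemma Run.pow {α σ : Type*} {M : NFA α σ} {p : σ} {y : List α}
    (h : Run M p y p) (i : ℕ) : Run M p (listPow y i) p := by
  induction i with
  | zero => exact Run.nil p
  | succ i ih => rw [listPow_succ]; exact h.append ih

lemma mem_evalFrom_iff {α σ : Type*} (M : NFA α σ) (w : List α) (S : Set σ) (r : σ) :
    r ∈ M.evalFrom S w ↔ ∃ p ∈ S, Run M p w r := by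
  induction w generalizing S with
  | nil =>
    constructor
    · intro h; exact ⟨r, h, Run.nil r⟩
    · rintro ⟨p, hp, h⟩; cases h; exact hp
  | cons a w ih =>
    rw [NFA.evalFrom_cons, ih]
    constructor
    · rintro ⟨q, hq, h⟩
      rw [NFA.mem_stepSet] at hq
      obtain ⟨p, hp, hs⟩ := hq
      exact ⟨p, hp, Run.cons _ _ _ _ _ hs h⟩
    · rintro ⟨p, hp, h⟩
      cases h with
      | cons _ q _ _ _ hs h => exact ⟨q, by rw [NFA.mem_stepSet]; exact ⟨p, hp, hs⟩, h⟩

lemma mem_accepts_iff_run {α σ : Type*} (M : NFA α σ) (w : List α) :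
    w ∈ M.accepts ↔ ∃ p ∈ M.start, ∃ r ∈ M.accept, Run M p w r := by
  constructor
  · rintro ⟨r, hr, h⟩
    obtain ⟨p, hp, h⟩ := (mem_evalFrom_iff M w _ r).1 h
    exact ⟨p, hp, r, hr, h⟩
  · rintro ⟨p, hp, r, hr, h⟩
    exact ⟨r, hr, (mem_evalFrom_iff M w _ r).2 ⟨p, hp, h⟩⟩

lemma Run.states {α σ : Type*} {M : NFA α σ} {p r : σ} {w : List α} (h : Run M p w r) :
    ∃ q : ℕ → σ, q 0 = p ∧ q w.length = r ∧
      ∀ a b, a ≤ b → b ≤ w.length → Run M (q a) ((w.drop a).take (b - a)) (q b) := by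
  induction h with
  | nil p =>
    refine ⟨fun _ => p, rfl, rfl, fun a b _ _ => ?_⟩
    simpa using Run.nil p
  | cons p p' r c w hs hr ih =>
    obtain ⟨q, q0, q1, hq⟩ := ih
    refine ⟨fun t => Nat.casesOn t p q, rfl, by simpa using q1, fun a b hab hb => ?_⟩
    rcases a with _ | a <;> rcases b with _ | b
    · simpa using Run.nil p
    · have := hq 0 b (by omega) (by simpa using hb)
      rw [q0] at this
      simpa using Run.cons _ _ _ _ _ hs this
    · omega
    · have := hq a b (by omega) (by simpa using hb)
      simpa using this

/-- If the language of an n-state NFA contains an unbordered word of length greater than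
4n² + 6n + 1, then it contains infinitely many unbordered words. -/
theorem nfa_infinitely_many_unbordered {α σ : Type*} [Fintype σ] (M : NFA α σ) (n : ℕ)
    (hn : Fintype.card σ = n)
    (h : ∃ w ∈ M.accepts, ¬ Bordered w ∧ 4 * n ^ 2 + 6 * n + 1 < w.length) :
    {w | w ∈ M.accepts ∧ ¬ Bordered w}.Infinite := by
  obtain ⟨w, hw, hnb, hlen⟩ := h
  obtain ⟨p, hp, r, hr, hrun⟩ := (mem_accepts_iff_run M w).1 hw
  obtain ⟨q, q0, q1, hq⟩ := hrun.states
  obtain ⟨a, b, hab, hb, hqa, hqb⟩ : ∃ a b, a < b ∧ 2 * b ≤ w.length ∧ q a = q b ∧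
      q (w.length - a) = q (w.length - b) := by
    have hcard : Fintype.card (σ × σ) < Fintype.card (Fin (n ^ 2 + 1)) := by
      rw [Fintype.card_prod, Fintype.card_fin, hn]; nlinarith
    obtain ⟨a, b, hne, he⟩ := Fintype.exists_ne_map_eq_of_card_lt
      (fun a : Fin (n ^ 2 + 1) => (q a, q (w.length - a))) hcard
    have ha := a.2
    have hb := b.2
    have hne' : (a : ℕ) ≠ b := fun h => hne (Fin.ext h)
    simp only [Prod.mk.injEq] at he
    rcases lt_or_gt_of_ne hne' with h | h
    · exact ⟨a, b, h, by omega, he.1, he.2⟩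
    · exact ⟨b, a, h, by omega, he.1.symm, he.2.symm⟩
  set N := w.length with hNdef
  intro hfin
  obtain ⟨B, hB⟩ := (hfin.image List.length).bddAbove
  have hB' : ∀ v ∈ M.accepts, B < v.length → Bordered v := by
    intro v hv hl
    by_contra hc
    have := hB ⟨v, ⟨hv, hc⟩, rfl⟩
    omega
  have hx := hq 0 a (by omega) (by omega)
  have hy := hq a b (by omega) (by omega)
  have hm := hq b (N - b) (by omega) (by omega)
  have hy' := hq (N - b) (N - a) (by omega) (by omega)
  have hz := hq (N - a) N (by omega) le_rfl
  have hwe : w = (w.drop 0).take (a - 0) ++ (w.drop a).take (b - a)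
      ++ (w.drop b).take (N - b - b) ++ (w.drop (N - b)).take (N - a - (N - b))
      ++ (w.drop (N - a)).take (N - (N - a)) := by
    have st : ∀ c d, c ≤ d → w.take c ++ (w.drop c).take (d - c) = w.take d := by
      intro c d hcd
      rw [← List.take_add]; congr 1; omega
    rw [List.drop_zero, Nat.sub_zero, st _ _ (by omega), st _ _ (by omega), st _ _ (by omega),
      st _ _ (by omega), hNdef, List.take_length]
  have lx : ((w.drop 0).take (a - 0)).length = a := by simp; omega
  have ly : ((w.drop a).take (b - a)).length = b - a := by simp; omega
  have ly' : ((w.drop (N - b)).take (N - a - (N - b))).length = b - a := by simp; omega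
  have lz : ((w.drop (N - a)).take (N - (N - a))).length = a := by simp; omega
  generalize (w.drop 0).take (a - 0) = x at *
  generalize (w.drop a).take (b - a) = y at *
  generalize (w.drop b).take (N - b - b) = m at *
  generalize (w.drop (N - b)).take (N - a - (N - b)) = y' at *
  generalize (w.drop (N - a)).take (N - (N - a)) = z at *
  rw [q0] at hx
  rw [q1] at hz
  rw [← hqa] at hy hm
  rw [hqb] at hy' hz
  have hbig : ∀ v : List α, 0 < v.length → B < (listPow v (N + B + 1)).length := by
    intro v hv
    rw [listPow_length]
    have := Nat.le_mul_of_pos_right (N + B + 1) hv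
    omega
  apply hnb
  rw [hwe]
  refine words x y m y' z (N + B) (by omega) (by omega) (by omega) (by rw [← hwe]; omega) ?_ ?_
  · apply hB'
    · refine (mem_accepts_iff_run M _).2 ⟨p, hp, r, hr, ?_⟩
      exact (hx.append (hy.pow _)).append ((hm.append hy').append hz)
    · have := hbig y (by omega)
      simp only [List.length_append]; omega
  · apply hB'
    · refine (mem_accepts_iff_run M _).2 ⟨p, hp, r, hr, ?_⟩
      exact (((hx.append hy).append hm).append (hy'.pow _)).append hz
    · have := hbig y' (by omega)
      simp only [List.length_append]; omega
end
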